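/- Let 0 ≤ m < ∞ and for 0 ≤ n ≤ m let ν̃_n be positive regular Borel measures on [0,∞), each satisfying the Δ₂-condition, with ν̃₀ not the zero measure; let ν_n := ν̃_n ⊗ λ where λ is Lebesgue measure on ℝ, and define the weight w_{(m)}(t) := 2π Σ_{n=0}^m t^{2n} ∫₀^∞ e^{−2rt} dν̃_n(r) for t > 0. Let μ be a positive Borel measure on ℂ₊ supported in the sector S(θ) for some 0 < θ < π/2. If there exist r₀ > 0 and a constant C > 0 such that for every k ∈ ℤ, μ(Q(2^k r₀)) ≤ C [ (ν₀(Q(2^k r₀)))^{−1/2} + ( Σ_{n=0}^m ν_n(Q(2^k r₀)) / (2^k r₀)^{2n} )^{−1/2} ]^{−2}, then there exists C′ > 0 such that ∫_{ℂ₊} |𝔏f|² dμ ≤ C′ ‖f‖²_{L²_{w_{(m)}}} for all f ∈ L²_{w_{(m)}}(0,∞); that is, μ is a Carleson measure for the space A²_{(m)} = 𝔏(L²_{w_{(m)}}(0,∞)). -/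

import Mathlib

open MeasureTheory Set Complex Filter ENNReal

/-- The Laplace transform of `f : (0,∞) → ℂ` at `z`. -/
noncomputable def laplaceT (f : ℝ → ℂ) (z : ℂ) : ℂ :=
  ∫ t in Set.Ioi (0:ℝ), f t * Complex.exp (-(t : ℂ) * z)

/-- The norm of `f` in the weighted space `L^p_w(0,∞)` (as an extended real). -/
noncomputable def lpwNorm (p : ℝ) (w : ℝ → ℝ) (f : ℝ → ℂ) : ℝ≥0∞ :=
  (∫⁻ t in Set.Ioi (0:ℝ), (‖f t‖₊ : ℝ≥0∞) ^ p * ENNReal.ofReal (w t)) ^ (1/p)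

/-- Boundedness of the Laplace–Carleson embedding `𝔏 : L^p_w(0,∞) → L^q(ℂ₊, μ)`. -/
def lcBounded (p q : ℝ) (w : ℝ → ℝ) (μ : Measure ℂ) : Prop :=
  ∃ C > 0, ∀ f : ℝ → ℂ, Measurable f →
    (∫⁻ z, (‖laplaceT f z‖₊ : ℝ≥0∞) ^ q ∂μ) ^ (1/q) ≤ ENNReal.ofReal C * lpwNorm p w f

/-- The Carleson square `Q(a)` centred at `a ∈ ℂ₊`. -/
def carlesonQ (a : ℂ) : Set ℂ :=
  {z : ℂ | 0 ≤ z.re ∧ z.re < 2 * a.re ∧ |z.im - a.im| ≤ a.re}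

/-- The measure `ν = ν̃ ⊗ λ` on the closed right half-plane `[0,∞) × ℝ ≅ ℂ`,
where `λ` is Lebesgue measure. -/
noncomputable def prodMeasC (ν' : Measure ℝ) : Measure ℂ :=
  (ν'.prod volume).map Complex.measurableEquivRealProd.symm

/-- The sector `S(θ) = {z ∈ ℂ₊ : |arg z| < θ}`. -/
def sector (θ : ℝ) : Set ℂ := {z : ℂ | 0 < z.re ∧ |Complex.arg z| < θ}

/-- The truncated sector `Δ_r = {z ∈ S(θ) : Re z ≤ r}`. -/
def sectorDelta (θ r : ℝ) : Set ℂ := {z ∈ sector θ | z.re ≤ r}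

/-- The weight `w_{(m)}(t) = 2π Σ_{n=0}^m t^{2n} ∫₀^∞ e^{-2rt} dν̃_n(r)`
(as an extended real). -/
noncomputable def wm (m : ℕ) (ν' : ℕ → Measure ℝ) (t : ℝ) : ℝ≥0∞ :=
  ENNReal.ofReal (2 * Real.pi) *
    ∑ n ∈ Finset.range (m + 1),
      ENNReal.ofReal (t ^ (2 * n)) * ∫⁻ r, ENNReal.ofReal (Real.exp (-(2 * r * t))) ∂(ν' n)

lemma prodMeasC_carlesonQ (ν : Measure ℝ) [SFinite ν] (a : ℝ) :
    prodMeasC ν (carlesonQ (a : ℂ)) = ν (Ico 0 (2 * a)) * ENNReal.ofReal (2 * a) := by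
  have hQ : Complex.measurableEquivRealProd.symm ⁻¹' carlesonQ (a : ℂ)
      = Ico 0 (2 * a) ×ˢ Icc (-a) a := by
    ext ⟨x, y⟩
    simp [carlesonQ, Complex.measurableEquivRealProd, abs_le, and_assoc]
  rw [prodMeasC, MeasurableEquiv.map_apply, hQ, Measure.prod_prod, Real.volume_Icc]
  ring_nf

lemma ENNReal.rpow_neg_half_add_rpow_neg_two_le (X Y : ℝ≥0∞) :
    (X ^ (-(1/2 : ℝ)) + Y) ^ (-(2 : ℝ)) ≤ X := by
  calc (X ^ (-(1/2 : ℝ)) + Y) ^ (-(2 : ℝ)) ≤ (X ^ (-(1/2 : ℝ))) ^ (-(2 : ℝ)) := by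
        rw [ENNReal.rpow_neg _ 2, ENNReal.rpow_neg _ 2]
        gcongr
        exact le_self_add
    _ = X := by rw [← ENNReal.rpow_mul]; norm_num

lemma abs_im_le_tan_mul_re {θ : ℝ} (hθ : θ < Real.pi / 2) {z : ℂ} (hz : z ∈ sector θ) :
    |z.im| ≤ Real.tan θ * z.re := by
  obtain ⟨hre, harg⟩ := hz
  obtain ⟨h1, h2⟩ := abs_lt.1 harg
  have hu := Real.tan_lt_tan_of_lt_of_lt_pi_div_two (by linarith) hθ h2
  have hl := Real.tan_lt_tan_of_lt_of_lt_pi_div_two (by linarith) (by linarith) h1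
  rw [Real.tan_neg] at hl
  rw [Complex.tan_arg] at hu hl
  rw [lt_div_iff₀ hre] at hl
  rw [div_lt_iff₀ hre] at hu
  exact abs_le.2 ⟨by linarith, hu.le⟩

lemma enorm_laplaceT_le (f : ℝ → ℂ) {x : ℝ} {z : ℂ} (hxz : x ≤ z.re) :
    ‖laplaceT f z‖ₑ ≤ ∫⁻ t in Ioi (0 : ℝ), ‖f t‖ₑ * ENNReal.ofReal (Real.exp (-(t * x))) := by
  refine (enorm_integral_le_lintegral_enorm _).trans ?_
  refine setLIntegral_mono' measurableSet_Ioi fun t ht => ?_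
  rw [enorm_mul]
  gcongr
  rw [← ofReal_norm, Complex.norm_exp]
  refine ENNReal.ofReal_le_ofReal (Real.exp_le_exp.2 ?_)
  have := mul_le_mul_of_nonneg_left hxz (le_of_lt (mem_Ioi.1 ht))
  simpa using this

lemma lintegral_rpow_neg_half_mul_exp {x : ℝ} (hx : 0 < x) :
    ∫⁻ t in Ioi (0 : ℝ), ENNReal.ofReal (t ^ (-(1/2) : ℝ) * Real.exp (-(t * x)))
      = ENNReal.ofReal (√Real.pi / √x) := by
  have hint := Real.integral_rpow_mul_exp_neg_mul_Ioi (a := 1/2) (r := x) (by norm_num) hx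
  have hval : (1 / x) ^ (1/2 : ℝ) * Real.Gamma (1/2) = √Real.pi / √x := by
    rw [Real.Gamma_one_half_eq, ← Real.sqrt_eq_rpow, Real.sqrt_div zero_le_one, Real.sqrt_one]
    ring
  have hexp : (1/2 - 1 : ℝ) = -(1/2) := by norm_num
  rw [hval, hexp] at hint
  have hcomm : ∀ t : ℝ, Real.exp (-(x * t)) = Real.exp (-(t * x)) := fun t => by rw [mul_comm]
  simp only [hcomm] at hint
  rw [← hint, ofReal_integral_eq_lintegral_ofReal]
  · refine Integrable.of_integral_ne_zero ?_
    rw [hint]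
    positivity
  · filter_upwards [ae_restrict_mem measurableSet_Ioi] with t ht
    have : 0 < t := ht
    positivity

lemma sq_lintegral_mul_exp_le {g : ℝ → ℝ≥0∞} (hg : Measurable g) {x : ℝ} (hx : 0 < x) :
    (∫⁻ t in Ioi (0 : ℝ), g t * ENNReal.ofReal (Real.exp (-(t * x)))) ^ (2 : ℝ) ≤
      ENNReal.ofReal (√Real.pi / √x) *
        ∫⁻ t in Ioi (0 : ℝ), g t ^ (2 : ℝ) * ENNReal.ofReal (√t * Real.exp (-(t * x))) := by
  let F : ℝ → ℝ≥0∞ := fun t => g t * ENNReal.ofReal (t ^ (1/4 : ℝ) * Real.exp (-(t * x) / 2))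
  let G : ℝ → ℝ≥0∞ := fun t => ENNReal.ofReal (t ^ (-(1/4) : ℝ) * Real.exp (-(t * x) / 2))
  have hF : Measurable F := by fun_prop
  have hG : Measurable G := by fun_prop
  have hexp : ∀ t : ℝ, Real.exp (-(t * x) / 2) ^ 2 = Real.exp (-(t * x)) := fun t => by
    rw [← Real.exp_nat_mul]; congr 1; push_cast; ring
  have hFG : ∫⁻ t in Ioi (0 : ℝ), g t * ENNReal.ofReal (Real.exp (-(t * x)))
      = ∫⁻ t in Ioi (0 : ℝ), (F * G) t := by
    refine setLIntegral_congr_fun measurableSet_Ioi fun t ht => ?_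
    have ht : 0 < t := ht
    simp only [F, G, Pi.mul_apply]
    rw [mul_assoc, ← ENNReal.ofReal_mul (by positivity)]
    congr 2
    rw [mul_mul_mul_comm, ← Real.rpow_add ht, ← sq, hexp]
    norm_num
  have hF2 : ∫⁻ t in Ioi (0 : ℝ), F t ^ (2 : ℝ)
      = ∫⁻ t in Ioi (0 : ℝ), g t ^ (2 : ℝ) * ENNReal.ofReal (√t * Real.exp (-(t * x))) := by
    refine setLIntegral_congr_fun measurableSet_Ioi fun t ht => ?_
    have ht : 0 < t := ht
    simp only [F]
    rw [ENNReal.mul_rpow_of_nonneg _ _ zero_le_two,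
      ENNReal.ofReal_rpow_of_nonneg (by positivity) zero_le_two, Real.rpow_two, mul_pow, hexp,
      ← Real.rpow_mul_natCast ht.le, Real.sqrt_eq_rpow]
    norm_num
  have hG2 : ∫⁻ t in Ioi (0 : ℝ), G t ^ (2 : ℝ) = ENNReal.ofReal (√Real.pi / √x) := by
    rw [← lintegral_rpow_neg_half_mul_exp hx]
    refine setLIntegral_congr_fun measurableSet_Ioi fun t ht => ?_
    have ht : 0 < t := ht
    simp only [G]
    rw [ENNReal.ofReal_rpow_of_nonneg (by positivity) zero_le_two, Real.rpow_two, mul_pow, hexp,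
      ← Real.rpow_mul_natCast ht.le]
    norm_num
  have hCS := ENNReal.lintegral_mul_le_Lp_mul_Lq (volume.restrict (Ioi (0 : ℝ)))
    Real.HolderConjugate.two_two hF.aemeasurable hG.aemeasurable
  rw [hFG]
  refine (ENNReal.rpow_le_rpow hCS zero_le_two).trans_eq ?_
  rw [ENNReal.mul_rpow_of_nonneg _ _ zero_le_two, ← ENNReal.rpow_mul, ← ENNReal.rpow_mul, hF2, hG2]
  norm_num [mul_comm]

lemma sqrt_mul_exp_neg_half_le {v : ℝ} (hv : 0 < v) : √v * Real.exp (-(v / 2)) ≤ 2 / √v := by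
  have h1 : v / 2 ≤ Real.exp (v / 2) := by linarith [Real.add_one_le_exp (v / 2)]
  rw [le_div_iff₀ (Real.sqrt_pos.2 hv), Real.exp_neg]
  calc √v * (Real.exp (v / 2))⁻¹ * √v = v * (Real.exp (v / 2))⁻¹ := by
        rw [mul_right_comm, Real.mul_self_sqrt hv.le]
    _ ≤ 2 := by
        rw [← div_eq_mul_inv, div_le_iff₀ (Real.exp_pos _)]
        linarith

lemma sqrt_mul_exp_neg_half_zpow_le {s : ℝ} (hs : 1 ≤ s) (hs2 : s ≤ 2) (k : ℤ) :
    √((2 : ℝ) ^ k * s) * Real.exp (-((2 : ℝ) ^ k * s / 2)) ≤ 2 * √(1/2) ^ k.natAbs := by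
  have hv : 0 < (2 : ℝ) ^ k * s := by positivity
  have hq : ∀ l : ℕ, √(1/2 : ℝ) ^ l = √((1/2) ^ l) := fun l => by
    rw [Real.sqrt_eq_rpow, Real.sqrt_eq_rpow, ← Real.rpow_natCast, ← Real.rpow_natCast,
      ← Real.rpow_mul (by norm_num), ← Real.rpow_mul (by norm_num), mul_comm]
  obtain ⟨l, rfl | rfl⟩ := k.eq_nat_or_neg
  · refine (sqrt_mul_exp_neg_half_le hv).trans ?_
    rw [Int.natAbs_natCast, hq, zpow_natCast, one_div, inv_pow, Real.sqrt_inv, div_eq_mul_inv]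
    gcongr
    exact le_mul_of_one_le_right (by positivity) hs
  · have h1 : Real.exp (-((2 : ℝ) ^ (-(l : ℤ)) * s / 2)) ≤ 1 := by
      rw [Real.exp_le_one_iff]
      linarith
    refine (mul_le_of_le_one_right (Real.sqrt_nonneg _) h1).trans ?_
    rw [Int.natAbs_neg, Int.natAbs_natCast, hq, zpow_neg, zpow_natCast, one_div, inv_pow,
      Real.sqrt_mul (by positivity), mul_comm]
    gcongr
    exact (Real.sqrt_le_sqrt hs2).trans (Real.sqrt_le_iff.2 (by norm_num))

lemma exists_tsum_sqrt_mul_exp_dyadic_le :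
    ∃ K > 0, ∀ u > 0,
      ∑' k : ℤ, ENNReal.ofReal (√((2 : ℝ) ^ k * u) * Real.exp (-((2 : ℝ) ^ k * u / 2)))
        ≤ ENNReal.ofReal K := by
  have hq1 : √(1/2 : ℝ) < 1 := by
    rw [Real.sqrt_lt' one_pos]; norm_num
  have hgeo : Summable fun l : ℕ => 2 * √(1/2 : ℝ) ^ l :=
    (summable_geometric_of_lt_one (Real.sqrt_nonneg _) hq1).mul_left 2
  have hsum : Summable fun k : ℤ => 2 * √(1/2 : ℝ) ^ k.natAbs :=
    Summable.of_nat_of_neg (by simpa using hgeo) (by simpa using hgeo)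
  refine ⟨∑' k : ℤ, 2 * √(1/2 : ℝ) ^ k.natAbs,
    hsum.tsum_pos (fun k => by positivity) 0 (by norm_num), fun u hu => ?_⟩
  obtain ⟨n, hn1, hn2⟩ := exists_mem_Ico_zpow hu one_lt_two
  rw [ENNReal.ofReal_tsum_of_nonneg (fun k => by positivity) hsum,
    ← (Equiv.subRight n).tsum_eq]
  refine ENNReal.tsum_le_tsum fun k => ENNReal.ofReal_le_ofReal ?_
  have h2n : (0 : ℝ) < 2 ^ n := by positivity
  have hk : (2 : ℝ) ^ (k - n) * u = 2 ^ k * (u / 2 ^ n) := by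
    rw [zpow_sub₀ two_ne_zero]; ring
  simp only [Equiv.subRight_apply, hk]
  refine sqrt_mul_exp_neg_half_zpow_le ((one_le_div h2n).2 hn1) ?_ k
  rw [div_le_iff₀ h2n]
  rw [zpow_add_one₀ two_ne_zero] at hn2
  linarith

lemma measure_Ico_two_pow_mul_le {ν : Measure ℝ} {D : ℝ≥0∞}
    (hD : ∀ r > 0, ν (Ico 0 (2 * r)) ≤ D * ν (Ico 0 r)) (p : ℕ) {r : ℝ} (hr : 0 < r) :
    ν (Ico 0 (2 ^ p * r)) ≤ D ^ p * ν (Ico 0 r) := by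
  induction p with
  | zero => simp
  | succ p ih =>
    calc ν (Ico 0 (2 ^ (p + 1) * r)) = ν (Ico 0 (2 * (2 ^ p * r))) := by ring_nf
      _ ≤ D * ν (Ico 0 (2 ^ p * r)) := hD _ (by positivity)
      _ ≤ D * (D ^ p * ν (Ico 0 r)) := by gcongr
      _ = D ^ (p + 1) * ν (Ico 0 r) := by ring

lemma exp_mul_measure_Ico_le (ν : Measure ℝ) {t x : ℝ} (ht : 0 < t) :
    ENNReal.ofReal (Real.exp (-(t * x / 2))) * ν (Ico 0 (x / 4)) ≤
      ∫⁻ r, ENNReal.ofReal (Real.exp (-(2 * r * t))) ∂ν := by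
  rw [← setLIntegral_const]
  refine (setLIntegral_mono' measurableSet_Ico fun r hr => ?_).trans (setLIntegral_le_lintegral _ _)
  refine ENNReal.ofReal_le_ofReal (Real.exp_le_exp.2 ?_)
  nlinarith [hr.2]

lemma lintegral_exp_le_wm (m : ℕ) (ν' : ℕ → Measure ℝ) (t : ℝ) :
    ∫⁻ r, ENNReal.ofReal (Real.exp (-(2 * r * t))) ∂(ν' 0) ≤ wm m ν' t := by
  have hπ : 1 ≤ ENNReal.ofReal (2 * Real.pi) := by
    rw [ENNReal.one_le_ofReal]
    linarith [Real.pi_gt_three]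
  refine le_trans ?_ (le_mul_of_one_le_left zero_le hπ)
  have h0 := Finset.single_le_sum
    (f := fun n => ENNReal.ofReal (t ^ (2 * n)) *
      ∫⁻ r, ENNReal.ofReal (Real.exp (-(2 * r * t))) ∂(ν' n))
    (fun _ _ => zero_le) (Finset.mem_range.2 m.succ_pos)
  rwa [mul_zero, pow_zero, ENNReal.ofReal_one, one_mul] at h0

lemma lintegral_sector_le_tsum {θ : ℝ} {μ : Measure ℂ} (hμ : μ (sector θ)ᶜ = 0) {b : ℝ}
    (hb : 0 < b) {G : ℂ → ℝ≥0∞} {H : ℝ → ℝ≥0∞} (hGH : ∀ x z, x ≤ z.re → G z ≤ H x) :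
    ∫⁻ z, G z ∂μ ≤
      ∑' k : ℤ, H (2 ^ k * b) * μ {z ∈ sector θ | z.re ∈ Ico (2 ^ k * b) (2 ^ (k + 1) * b)} := by
  have hcover : sector θ ⊆
      ⋃ k : ℤ, {z ∈ sector θ | z.re ∈ Ico (2 ^ k * b) (2 ^ (k + 1) * b)} := fun z hz => by
    obtain ⟨k, hk1, hk2⟩ := exists_mem_Ico_zpow (div_pos hz.1 hb) one_lt_two
    exact mem_iUnion.2 ⟨k, hz, (le_div_iff₀ hb).1 hk1, (div_lt_iff₀ hb).1 hk2⟩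
  have hrestrict : μ.restrict (sector θ) = μ := Measure.restrict_eq_self_of_ae_mem hμ
  calc ∫⁻ z, G z ∂μ = ∫⁻ z in sector θ, G z ∂μ := by rw [hrestrict]
    _ ≤ ∫⁻ z in ⋃ k : ℤ, {z ∈ sector θ | z.re ∈ Ico (2 ^ k * b) (2 ^ (k + 1) * b)}, G z ∂μ :=
        lintegral_mono_set hcover
    _ ≤ ∑' k : ℤ, ∫⁻ z in {z ∈ sector θ | z.re ∈ Ico (2 ^ k * b) (2 ^ (k + 1) * b)}, G z ∂μ :=
        lintegral_iUnion_le _ _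
    _ ≤ _ := by
        refine ENNReal.tsum_le_tsum fun k => ?_
        rw [← setLIntegral_const]
        exact setLIntegral_mono measurable_const fun z hz => hGH _ _ hz.2.1

lemma tsum_sq_laplace_mul_measure_le {ν : Measure ℝ} {K : ℝ}
    (hK : ∀ u > 0,
      ∑' k : ℤ, ENNReal.ofReal (√((2 : ℝ) ^ k * u) * Real.exp (-((2 : ℝ) ^ k * u / 2)))
        ≤ ENNReal.ofReal K)
    {b : ℝ} (hb : 0 < b) {g : ℝ → ℝ≥0∞} (hg : Measurable g) :
    ∑' k : ℤ, (∫⁻ t in Ioi (0 : ℝ), g t * ENNReal.ofReal (Real.exp (-(t * (2 ^ k * b))))) ^ (2 : ℝ)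
        * (ENNReal.ofReal (2 ^ k * b) * ν (Ico 0 (2 ^ k * b / 4)))
      ≤ ENNReal.ofReal (√Real.pi * K) * ∫⁻ t in Ioi (0 : ℝ),
          g t ^ (2 : ℝ) * ∫⁻ r, ENNReal.ofReal (Real.exp (-(2 * r * t))) ∂ν := by
  set x : ℤ → ℝ := fun k => 2 ^ k * b with hx
  have hxpos : ∀ k, 0 < x k := fun k => by positivity
  let c : ℤ → ℝ≥0∞ := fun k => ENNReal.ofReal √(x k) * ν (Ico 0 (x k / 4))
  let h : ℤ → ℝ → ℝ≥0∞ := fun k t => g t ^ (2 : ℝ) * ENNReal.ofReal (√t * Real.exp (-(t * x k)))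
  have hh : ∀ k, Measurable (h k) := fun k => by fun_prop
  have hterm : ∀ k,
      (∫⁻ t in Ioi (0 : ℝ), g t * ENNReal.ofReal (Real.exp (-(t * x k)))) ^ (2 : ℝ)
        * (ENNReal.ofReal (x k) * ν (Ico 0 (x k / 4)))
      ≤ ENNReal.ofReal √Real.pi * ∫⁻ t in Ioi (0 : ℝ), c k * h k t := fun k => by
    have hsq : ENNReal.ofReal (√Real.pi / √(x k)) * ENNReal.ofReal (x k)
        = ENNReal.ofReal √Real.pi * ENNReal.ofReal √(x k) := by
      rw [← ENNReal.ofReal_mul (by positivity), ← ENNReal.ofReal_mul (by positivity),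
        div_mul_eq_mul_div, mul_div_assoc, Real.div_sqrt]
    calc _ ≤ (ENNReal.ofReal (√Real.pi / √(x k)) * ∫⁻ t in Ioi (0 : ℝ), h k t)
          * (ENNReal.ofReal (x k) * ν (Ico 0 (x k / 4))) := by
          gcongr
          exact sq_lintegral_mul_exp_le hg (hxpos k)
      _ = (ENNReal.ofReal (√Real.pi / √(x k)) * ENNReal.ofReal (x k))
          * (ν (Ico 0 (x k / 4)) * ∫⁻ t in Ioi (0 : ℝ), h k t) := by ring
      _ = ENNReal.ofReal √Real.pi * ∫⁻ t in Ioi (0 : ℝ), c k * h k t := by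
          rw [hsq, lintegral_const_mul _ (hh k)]
          ring
  refine (ENNReal.tsum_le_tsum hterm).trans ?_
  rw [ENNReal.tsum_mul_left,
    ← lintegral_tsum fun k => ((hh k).const_mul (c k)).aemeasurable,
    ENNReal.ofReal_mul (Real.sqrt_nonneg _), mul_assoc]
  gcongr ENNReal.ofReal √Real.pi * ?_
  rw [← lintegral_const_mul' _ _ ENNReal.ofReal_ne_top]
  refine setLIntegral_mono' measurableSet_Ioi fun t ht => ?_
  have ht : 0 < t := ht
  set W := ∫⁻ r, ENNReal.ofReal (Real.exp (-(2 * r * t))) ∂ν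
  calc ∑' k, c k * h k t
      = ∑' k : ℤ, ENNReal.ofReal (√((2 : ℝ) ^ k * (b * t)) *
            Real.exp (-((2 : ℝ) ^ k * (b * t) / 2))) *
          (g t ^ (2 : ℝ) *
            (ENNReal.ofReal (Real.exp (-(t * x k / 2))) * ν (Ico 0 (x k / 4)))) := by
        refine tsum_congr fun k => ?_
        have hreal : √(x k) * (√t * Real.exp (-(t * x k)))
            = √((2 : ℝ) ^ k * (b * t)) * Real.exp (-((2 : ℝ) ^ k * (b * t) / 2)) *
              Real.exp (-(t * x k / 2)) := by
          have hexp : -(t * x k) = -((2 : ℝ) ^ k * (b * t) / 2) + -(t * x k / 2) := by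
            simp only [hx]; ring
          rw [hexp, Real.exp_add, ← mul_assoc, ← mul_assoc, ← Real.sqrt_mul (hxpos k).le,
            ← mul_assoc]
        have hE := congrArg ENNReal.ofReal hreal
        rw [ENNReal.ofReal_mul (p := √(x k)) (by positivity),
          ENNReal.ofReal_mul (q := Real.exp (-(t * x k / 2))) (by positivity)] at hE
        calc c k * h k t = (ENNReal.ofReal √(x k) * ENNReal.ofReal (√t * Real.exp (-(t * x k))))
              * (g t ^ (2 : ℝ) * ν (Ico 0 (x k / 4))) := by ring
          _ = _ := by rw [hE]; ring
    _ ≤ ∑' k : ℤ, ENNReal.ofReal (√((2 : ℝ) ^ k * (b * t)) *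
            Real.exp (-((2 : ℝ) ^ k * (b * t) / 2))) * (g t ^ (2 : ℝ) * W) := by
        gcongr
        exact exp_mul_measure_Ico_le ν ht
    _ ≤ ENNReal.ofReal K * (g t ^ (2 : ℝ) * W) := by
        rw [ENNReal.tsum_mul_right]
        gcongr
        exact hK _ (by positivity)

/-- if `μ` is supported in a sector `S(θ)` and satisfies the dyadic
Carleson-square condition
`μ(Q(2^k r₀)) ≤ C [ (ν₀(Q(2^k r₀)))^{-1/2} + (Σ_{n=0}^m ν_n(Q(2^k r₀))/(2^k r₀)^{2n})^{-1/2} ]^{-2}`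
for all `k ∈ ℤ`, then `μ` is a Carleson measure for `A²_{(m)} = 𝔏(L²_{w_{(m)}}(0,∞))`. -/
theorem carleson_measure_for_A2m_of_dyadic_bounds
    (m : ℕ) (ν' : ℕ → Measure ℝ) (hreg : ∀ n ≤ m, (ν' n).Regular)
    (hsupp : ∀ n ≤ m, ν' n {x : ℝ | x < 0} = 0)
    (hν0 : ν' 0 ≠ 0)
    (hΔ₂ : ∀ n ≤ m, ∃ R : ℝ, 0 ≤ R ∧
      ∀ r > 0, ν' n (Set.Ico 0 (2 * r)) ≤ ENNReal.ofReal R * ν' n (Set.Ico 0 r))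
    (θ : ℝ) (hθ0 : 0 < θ) (hθ : θ < Real.pi / 2)
    (μ : Measure ℂ) (hsuppμ : μ ((sector θ)ᶜ) = 0)
    (hdyadic : ∃ r₀ > 0, ∃ C > 0, ∀ k : ℤ,
      μ (carlesonQ (((2 : ℝ) ^ k * r₀ : ℝ) : ℂ)) ≤
        ENNReal.ofReal C *
          ((prodMeasC (ν' 0) (carlesonQ (((2 : ℝ) ^ k * r₀ : ℝ) : ℂ))) ^ (-(1/2 : ℝ)) +
            (∑ n ∈ Finset.range (m + 1),
              prodMeasC (ν' n) (carlesonQ (((2 : ℝ) ^ k * r₀ : ℝ) : ℂ)) /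
                ENNReal.ofReal (((2 : ℝ) ^ k * r₀) ^ (2 * n))) ^ (-(1/2 : ℝ))) ^ (-(2 : ℝ))) :
    ∃ C' > 0, ∀ f : ℝ → ℂ, Measurable f →
      (∫⁻ z, (‖laplaceT f z‖₊ : ℝ≥0∞) ^ (2 : ℝ) ∂μ) ≤
        ENNReal.ofReal C' *
          ∫⁻ t in Set.Ioi (0:ℝ), (‖f t‖₊ : ℝ≥0∞) ^ (2 : ℝ) * wm m ν' t := by
  obtain ⟨r₀, hr₀, C, hC, hdyadic⟩ := hdyadic
  obtain ⟨R, hR, hD⟩ := hΔ₂ 0 (Nat.zero_le m)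
  obtain ⟨K, hK0, hK⟩ := exists_tsum_sqrt_mul_exp_dyadic_le
  have := hreg 0 (Nat.zero_le m)
  obtain ⟨j, hj⟩ := pow_unbounded_of_one_lt (Real.tan θ) one_lt_two
  set b : ℝ := r₀ / 2 ^ (j + 1) with hb_def
  have hb : 0 < b := by positivity
  have hr₀b : r₀ = 2 ^ (j + 1) * b := by rw [hb_def]; field_simp
  set L : ℝ := C * R ^ (j + 4) * 2 ^ (j + 2) with hL
  have hstrip : ∀ k : ℤ, μ {z ∈ sector θ | z.re ∈ Ico (2 ^ k * b) (2 ^ (k + 1) * b)} ≤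
      ENNReal.ofReal L * (ENNReal.ofReal (2 ^ k * b) * ν' 0 (Ico 0 (2 ^ k * b / 4))) := by
    intro k
    have hxk : 0 < (2 : ℝ) ^ k * b := by positivity
    have hy : 2 * (2 ^ k * r₀) = 2 ^ (j + 2) * (2 ^ k * b) := by rw [hr₀b]; ring
    have hsub : {z ∈ sector θ | z.re ∈ Ico (2 ^ k * b) (2 ^ (k + 1) * b)} ⊆
        carlesonQ ((2 ^ k * r₀ : ℝ) : ℂ) := by
      rintro z ⟨hz, -, hzre⟩
      have him := abs_im_le_tan_mul_re hθ hz
      rw [zpow_add_one₀ two_ne_zero] at hzre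
      have hj1 : (1 : ℝ) ≤ 2 ^ j := one_le_pow₀ one_le_two
      have hyj : 2 ^ k * r₀ = 2 ^ j * (2 * (2 ^ k * b)) := by rw [hr₀b]; ring
      refine ⟨hz.1.le, ?_, ?_⟩
      · rw [Complex.ofReal_re, hyj]
        nlinarith
      · rw [Complex.ofReal_re, Complex.ofReal_im, sub_zero, hyj]
        refine him.trans ?_
        have := hz.1
        gcongr
        linarith
    calc μ {z ∈ sector θ | z.re ∈ Ico (2 ^ k * b) (2 ^ (k + 1) * b)}
        ≤ μ (carlesonQ ((2 ^ k * r₀ : ℝ) : ℂ)) := measure_mono hsub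
      _ ≤ ENNReal.ofReal C * prodMeasC (ν' 0) (carlesonQ ((2 ^ k * r₀ : ℝ) : ℂ)) :=
          (hdyadic k).trans (by
            gcongr
            exact ENNReal.rpow_neg_half_add_rpow_neg_two_le _ _)
      _ = ENNReal.ofReal C * (ν' 0 (Ico 0 (2 ^ (j + 4) * (2 ^ k * b / 4))) *
            ENNReal.ofReal (2 ^ (j + 2) * (2 ^ k * b))) := by
          rw [prodMeasC_carlesonQ, hy]
          congr 4
          ring
      _ ≤ ENNReal.ofReal C * ((ENNReal.ofReal R ^ (j + 4) * ν' 0 (Ico 0 (2 ^ k * b / 4))) *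
            ENNReal.ofReal (2 ^ (j + 2) * (2 ^ k * b))) := by
          gcongr
          exact measure_Ico_two_pow_mul_le hD _ (by positivity)
      _ = _ := by
          rw [hL, ENNReal.ofReal_mul (p := 2 ^ (j + 2)) (by positivity),
            ENNReal.ofReal_mul (p := C * R ^ (j + 4)) (by positivity),
            ENNReal.ofReal_mul hC.le, ENNReal.ofReal_pow hR]
          ring
  refine ⟨L * (√Real.pi * K) + 1, by positivity, fun f hf => ?_⟩
  have hsectors := lintegral_sector_le_tsum hsuppμ hb
    (G := fun z => ‖laplaceT f z‖ₑ ^ (2 : ℝ))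
    (H := fun x => (∫⁻ t in Ioi (0 : ℝ),
      ‖f t‖ₑ * ENNReal.ofReal (Real.exp (-(t * x)))) ^ (2 : ℝ))
    fun x z hxz => ENNReal.rpow_le_rpow (enorm_laplaceT_le f hxz) zero_le_two
  calc ∫⁻ z, ‖laplaceT f z‖ₑ ^ (2 : ℝ) ∂μ
      ≤ ∑' k : ℤ, ENNReal.ofReal L * ((∫⁻ t in Ioi (0 : ℝ),
          ‖f t‖ₑ * ENNReal.ofReal (Real.exp (-(t * (2 ^ k * b))))) ^ (2 : ℝ) *
          (ENNReal.ofReal (2 ^ k * b) * ν' 0 (Ico 0 (2 ^ k * b / 4)))) := by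
        refine hsectors.trans (ENNReal.tsum_le_tsum fun k => ?_)
        rw [mul_left_comm]
        gcongr
        exact hstrip k
    _ ≤ ENNReal.ofReal L * (ENNReal.ofReal (√Real.pi * K) * ∫⁻ t in Ioi (0 : ℝ),
          ‖f t‖ₑ ^ (2 : ℝ) * ∫⁻ r, ENNReal.ofReal (Real.exp (-(2 * r * t))) ∂(ν' 0)) := by
        rw [ENNReal.tsum_mul_left]
        gcongr
        exact tsum_sq_laplace_mul_measure_le hK hb hf.enorm
    _ ≤ ENNReal.ofReal (L * (√Real.pi * K) + 1) *
          ∫⁻ t in Ioi (0 : ℝ), ‖f t‖ₑ ^ (2 : ℝ) * wm m ν' t := by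
        rw [← mul_assoc, ← ENNReal.ofReal_mul (by positivity)]
        gcongr
        · linarith
        · exact lintegral_exp_le_wm m ν' _
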